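/- Let n, p, m : ℕ with 2 ≤ n, and let u : Fin n → EuclideanSpace ℂ (Fin p) and v : Fin n → EuclideanSpace ℂ (Fin m) be orthonormal families. Define the product states Θ_k ∈ EuclideanSpace ℂ (Fin p × Fin m) by Θ_k(i,j) = u_k(i) * v_k(j). Then there exists a family Ψ : Fin n → EuclideanSpace ℂ (Fin p × Fin m) such that: (a) Ψ is orthonormal; (b) the span of {Ψ_k} equals the span of {Θ_k}; and (c) every Ψ_k is entangled, i.e., there exist no x : Fin p → ℂ and y : Fin m → ℂ with Ψ_k(i,j) = x i * y j for all i, j. -/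

import Mathlib

/-- The elementary tensor `x ⊗ y`, as a vector indexed by pairs of coordinates. -/
noncomputable def productState {ι κ : Type*} (x : EuclideanSpace ℂ ι) (y : EuclideanSpace ℂ κ) :
    EuclideanSpace ℂ (ι × κ) :=
  WithLp.toLp 2 fun q => x q.1 * y q.2

theorem inner_productState {ι κ : Type*} [Fintype ι] [Fintype κ]
    (x x' : EuclideanSpace ℂ ι) (y y' : EuclideanSpace ℂ κ) :
    inner ℂ (productState x y) (productState x' y') = inner ℂ x x' * inner ℂ y y' := by
  simp only [productState, PiLp.inner_apply, RCLike.inner_apply, Fintype.sum_prod_type,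
    Finset.sum_mul_sum, map_mul]
  exact Finset.sum_congr rfl fun i _ => Finset.sum_congr rfl fun j _ => by ring

/-- Adding a suitable multiple of the sum `∑ l, e l` to every member of an orthonormal family
keeps it orthonormal. -/
theorem Orthonormal.add_smul_sum {ι E : Type*} [Fintype ι] [NormedAddCommGroup E]
    [InnerProductSpace ℂ E] {e : ι → E} (he : Orthonormal ℂ e) {c : ℂ}
    (hc : c + star c + Fintype.card ι * (star c * c) = 0) :
    Orthonormal ℂ fun k => e k + c • ∑ l, e l := by
  classical
  rw [orthonormal_iff_ite] at he ⊢
  intro k l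
  simp only [inner_add_left, inner_add_right, inner_smul_left, inner_smul_right, inner_sum,
    sum_inner, he, Finset.sum_add_distrib, Finset.sum_ite_eq, Finset.sum_ite_eq', Finset.mem_univ,
    if_true, Finset.sum_const, Finset.card_univ, nsmul_eq_mul, mul_one, starRingEnd_apply]
  linear_combination hc

/-- **Maximal Orthonormal Packaged Entangled Basis**: if the charge sector is
spanned by `n ≥ 2` orthonormal product states `Θ k (i, j) = u k i * v k j`
(built from orthonormal families `u`, `v`), then there is an orthonormal family
`Ψ` with the same span all of whose members are entangled (non-separable). -/
theorem exists_orthonormal_entangled_basis_of_product_states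
    {n p m : ℕ} (hn : 2 ≤ n)
    (u : Fin n → EuclideanSpace ℂ (Fin p))
    (v : Fin n → EuclideanSpace ℂ (Fin m))
    (hu : Orthonormal ℂ u) (hv : Orthonormal ℂ v)
    (Θ : Fin n → EuclideanSpace ℂ (Fin p × Fin m))
    (hΘ : ∀ (k : Fin n) (i : Fin p) (j : Fin m), Θ k (i, j) = u k i * v k j) :
    ∃ Ψ : Fin n → EuclideanSpace ℂ (Fin p × Fin m),
      Orthonormal ℂ Ψ
      ∧ Submodule.span ℂ (Set.range Ψ) = Submodule.span ℂ (Set.range Θ)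
      ∧ ∀ k : Fin n,
          ¬ ∃ (x : Fin p → ℂ) (y : Fin m → ℂ),
              ∀ (i : Fin p) (j : Fin m), Ψ k (i, j) = x i * y j := by
  have hΘ_eq : ∀ k, Θ k = productState (u k) (v k) := fun k => by
    ext q
    exact hΘ k q.1 q.2
  have hu' := orthonormal_iff_ite.mp hu
  have hv' := orthonormal_iff_ite.mp hv
  have hΘ_on : Orthonormal ℂ Θ := by
    rw [orthonormal_iff_ite]
    intro k l
    rw [hΘ_eq, hΘ_eq, inner_productState, hu', hv']
    split_ifs <;> simp
  have hn0 : (n : ℂ) ≠ 0 := Nat.cast_ne_zero.mpr (by omega)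
  obtain ⟨c, hc⟩ : ∃ c : ℂ, n * c = Complex.I - 1 := ⟨(Complex.I - 1) / n, by field_simp⟩
  have hc_star : n * star c = -Complex.I - 1 := by
    simpa using congrArg star hc
  have hc0 : c ≠ 0 := by
    rintro rfl
    simpa using congrArg Complex.im hc
  have hc1 : 1 + c ≠ 0 := by
    intro h
    have := congrArg Complex.im (show -(n : ℂ) = Complex.I - 1 by linear_combination hc - n * h)
    simp at this
  have hΨ : Orthonormal ℂ fun k => Θ k + c • ∑ l, Θ l := by
    refine hΘ_on.add_smul_sum (mul_left_cancel₀ hn0 ?_)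
    rw [Fintype.card_fin]
    linear_combination (1 + n * star c) * hc + Complex.I * hc_star - Complex.I_mul_I
  refine ⟨_, hΨ, ?_, ?_⟩
  · refine Submodule.eq_of_le_of_finrank_eq (Submodule.span_le.mpr ?_) ?_
    · rintro _ ⟨k, rfl⟩
      have hmem : ∀ l, Θ l ∈ Submodule.span ℂ (Set.range Θ) :=
        fun l => Submodule.subset_span ⟨l, rfl⟩
      exact Submodule.add_mem _ (hmem k)
        (Submodule.smul_mem _ _ (Submodule.sum_mem _ fun l _ => hmem l))
    · rw [finrank_span_eq_card hΨ.linearIndependent,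
        finrank_span_eq_card hΘ_on.linearIndependent]
  · rintro k ⟨x, y, hxy⟩
    have hprod : Θ k + c • ∑ l, Θ l = productState (WithLp.toLp 2 x) (WithLp.toLp 2 y) := by
      ext q
      exact hxy q.1 q.2
    have hcoeff : ∀ a b, inner ℂ (u a) (WithLp.toLp 2 x) * inner ℂ (v b) (WithLp.toLp 2 y) =
        if a = b then (if a = k then 1 else 0) + c else 0 := by
      intro a b
      rw [← inner_productState, ← hprod]
      simp only [hΘ_eq, inner_add_right, inner_smul_right, inner_sum, inner_productState, hu', hv']
      by_cases hab : a = b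
      · subst hab
        simp
      · have hzero : ∀ l, (if a = l then (1 : ℂ) else 0) * (if b = l then 1 else 0) = 0 := by
          intro l
          split_ifs with h₁ h₂ <;> simp_all
        simp [hzero, hab]
    have hdiag : ∀ a,
        inner ℂ (u a) (WithLp.toLp 2 x) * inner ℂ (v a) (WithLp.toLp 2 y) ≠ 0 := by
      intro a
      rw [hcoeff, if_pos rfl]
      split_ifs
      · exact hc1
      · simpa using hc0
    have : Nontrivial (Fin n) := Fin.nontrivial_iff_two_le.mpr hn
    obtain ⟨a, b, hab⟩ := exists_pair_ne (Fin n)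
    exact mul_ne_zero (left_ne_zero_of_mul (hdiag a)) (right_ne_zero_of_mul (hdiag b))
      (by rw [hcoeff, if_neg hab])
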